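/- Let K ⊆ ℝⁿ be a polyhedron (a finite intersection of closed half-spaces) with nonempty interior, and let y : [0,∞) → ℝⁿ be right-continuous with left limits with y₀ ∈ K. Then a solution x to the Skorokhod problem for y on K exists, is unique, and is right-continuous with left limits. -/

import Mathlib

open MeasureTheory Set Filter
open scoped InnerProductSpace

noncomputable section

/-- The (outward) normal cone of a set `K` at a point `x`. -/
def normalCone {n : ℕ} (K : Set (EuclideanSpace ℝ (Fin n)))
    (x : EuclideanSpace ℝ (Fin n)) : Set (EuclideanSpace ℝ (Fin n)) :=
  {w | ∀ y ∈ K, ⟪w, y - x⟫_ℝ ≤ 0}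

/-- A path `f : [0,∞) → ℝⁿ` is right-continuous with left limits. -/
def RCLL {n : ℕ} (f : ℝ → EuclideanSpace ℝ (Fin n)) : Prop :=
  (∀ t : ℝ, 0 ≤ t → ContinuousWithinAt f (Ici t) t) ∧
  (∀ t : ℝ, 0 < t → ∃ L, Tendsto f (nhdsWithin t (Iio t)) (nhds L))

/-- `x` solves the Skorokhod problem for `y` on `K`. -/
def IsSkorokhodSolution {n : ℕ} (K : Set (EuclideanSpace ℝ (Fin n)))
    (y x : ℝ → EuclideanSpace ℝ (Fin n)) : Prop :=
  (∀ t : ℝ, 0 ≤ t → x t ∈ K) ∧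
  ∃ (v : ℝ → EuclideanSpace ℝ (Fin n)) (μ : Measure ℝ),
    Measurable v ∧
    (∀ T : ℝ, 0 < T → μ (Ico 0 T) < ⊤) ∧
    (∀ s : ℝ, ‖v s‖ = 0 ∨ ‖v s‖ = 1) ∧
    (∀ s : ℝ, 0 ≤ s → v s ∈ normalCone K (x s)) ∧
    μ {s : ℝ | x s ∈ frontier K}ᶜ = 0 ∧
    ∀ t : ℝ, 0 ≤ t → x t = y t - ∫ s in Icc (0 : ℝ) t, v s ∂μ

/-- A relaxed form of the Skorokhod problem in which the density `g` of the reflection term is only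
required to have norm at most one. -/
structure IsReflection {n : ℕ} (K : Set (EuclideanSpace ℝ (Fin n)))
    (y x : ℝ → EuclideanSpace ℝ (Fin n)) (ν : Measure ℝ)
    (g : ℝ → EuclideanSpace ℝ (Fin n)) : Prop where
  mem : ∀ t, 0 ≤ t → x t ∈ K
  measurable : Measurable g
  norm_le : ∀ s, ‖g s‖ ≤ 1
  finite : ∀ T, ν (Icc 0 T) < ⊤
  normal : ∀ s, 0 ≤ s → g s ∈ normalCone K (x s)
  eq : ∀ t, 0 ≤ t → x t = y t - ∫ s in Icc (0 : ℝ) t, g s ∂ν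

section SkorokhodProblem

variable {n : ℕ}

local notation "E" => EuclideanSpace ℝ (Fin n)

theorem integrable_indicator_inner {ν : Measure ℝ} [IsFiniteMeasure ν]
    {g : ℝ → E} (hg : Integrable g ν) {S : Set (ℝ × ℝ)} (hS : MeasurableSet S) :
    Integrable (S.indicator fun p : ℝ × ℝ => ⟪g p.1, g p.2⟫_ℝ) (ν.prod ν) := by
  refine Integrable.indicator ?_ hS
  refine Integrable.mono' (hg.norm.mul_prod hg.norm) ?_ ?_
  · exact (hg.aestronglyMeasurable.comp_fst).inner (hg.aestronglyMeasurable.comp_snd)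
  · exact Eventually.of_forall fun p => norm_inner_le_norm _ _

theorem norm_integral_sq_le {ν : Measure ℝ} [IsFiniteMeasure ν] {g : ℝ → E}
    (hg : Integrable g ν) :
    Integrable (fun s => ⟪∫ r in Iic s, g r ∂ν, g s⟫_ℝ) ν ∧
    ‖∫ s, g s ∂ν‖ ^ 2 ≤ 2 * ∫ s, ⟪∫ r in Iic s, g r ∂ν, g s⟫_ℝ ∂ν := by
  set k : ℝ × ℝ → ℝ := fun p => ⟪g p.1, g p.2⟫_ℝ with hk
  set S : Set (ℝ × ℝ) := {p | p.1 ≤ p.2} with hSdef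
  set S' : Set (ℝ × ℝ) := {p | p.2 ≤ p.1} with hSdef'
  have hS : MeasurableSet S := measurableSet_le measurable_fst measurable_snd
  have hS' : MeasurableSet S' := measurableSet_le measurable_snd measurable_fst
  have hi := integrable_indicator_inner hg hS
  have hi' := integrable_indicator_inner hg hS'
  have hsec : ∀ s, ∫ r, S.indicator k (r, s) ∂ν = ⟪∫ r in Iic s, g r ∂ν, g s⟫_ℝ := by
    intro s
    have : (fun r => S.indicator k (r, s)) = (Iic s).indicator fun r => ⟪g r, g s⟫_ℝ := by
      ext r
      simp [S, k, indicator_apply]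
    rw [this, integral_indicator measurableSet_Iic]
    simp_rw [real_inner_comm (g s)]
    rw [integral_inner hg.integrableOn, real_inner_comm]
  have hint : ∫ p, S.indicator k p ∂(ν.prod ν) = ∫ s, ⟪∫ r in Iic s, g r ∂ν, g s⟫_ℝ ∂ν := by
    rw [integral_prod_symm _ hi]
    exact integral_congr_ae (Eventually.of_forall hsec)
  have hswap : ∫ p, S'.indicator k p ∂(ν.prod ν) = ∫ p, S.indicator k p ∂(ν.prod ν) := by
    rw [← integral_prod_swap]
    refine integral_congr_ae (Eventually.of_forall fun p => ?_)
    simp [S, S', k, indicator_apply, real_inner_comm]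
  have htot : ∫ p, k p ∂(ν.prod ν) = ‖∫ s, g s ∂ν‖ ^ 2 := by
    have hki : Integrable k (ν.prod ν) := by
      simpa using integrable_indicator_inner hg MeasurableSet.univ
    rw [integral_prod _ hki]
    have : ∀ r, ∫ s, k (r, s) ∂ν = ⟪∫ s, g s ∂ν, g r⟫_ℝ := by
      intro r
      rw [real_inner_comm, ← integral_inner hg]
    simp_rw [this]
    rw [integral_inner hg, real_inner_self_eq_norm_sq]
  refine ⟨?_, ?_⟩
  · exact hi.integral_prod_right.congr (Eventually.of_forall hsec)
  · rw [← htot, ← hint, two_mul]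
    nth_rw 2 [← hswap]
    rw [← integral_add hi hi']
    refine integral_mono ?_ (hi.add hi') fun p => ?_
    · simpa using integrable_indicator_inner hg MeasurableSet.univ
    · simp only [indicator_apply, S, S', k, mem_ofPred_eq]
      rcases lt_trichotomy p.1 p.2 with h | h | h
      · simp [h.le, h.not_ge]
      · simp [h]
      · simp [h.le, h.not_ge]

theorem IsReflection.integrableOn {K : Set E} {y x g : ℝ → E} {ν : Measure ℝ}
    (h : IsReflection K y x ν g) {A : Set ℝ} {T : ℝ} (hA : A ⊆ Icc 0 T) :
    IntegrableOn g A ν := by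
  refine IntegrableOn.mono_set ?_ hA
  have : IsFiniteMeasure (ν.restrict (Icc 0 T)) := ⟨by simpa using h.finite T⟩
  exact Integrable.of_bound h.measurable.aestronglyMeasurable 1
    (Eventually.of_forall h.norm_le)

theorem IsReflection.norm_sub_sq_le {K : Set E} {y₁ x₁ g₁ y₂ x₂ g₂ : ℝ → E} {ν₁ ν₂ : Measure ℝ}
    (h₁ : IsReflection K y₁ x₁ ν₁ g₁) (h₂ : IsReflection K y₂ x₂ ν₂ g₂) {t δ : ℝ} (ht : 0 ≤ t)
    (hδ : ∀ s ∈ Icc 0 t, ‖y₁ s - y₂ s‖ ≤ δ) :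
    ‖x₁ t - x₂ t‖ ^ 2 ≤ δ ^ 2 +
      4 * δ * (∫ s in Icc 0 t, ‖g₁ s‖ ∂ν₁ + ∫ s in Icc 0 t, ‖g₂ s‖ ∂ν₂) := by
  set m₁ := ν₁.restrict (Icc 0 t) with hm₁
  set m₂ := ν₂.restrict (Icc 0 t) with hm₂
  have : IsFiniteMeasure m₁ := ⟨by simpa [m₁] using h₁.finite t⟩
  have : IsFiniteMeasure m₂ := ⟨by simpa [m₂] using h₂.finite t⟩
  set ν := m₁ + m₂ with hν
  have ac₁ : m₁ ≪ ν := Measure.AbsolutelyContinuous.rfl.add_right _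
  have ac₂ : m₂ ≪ ν := by
    rw [hν, add_comm]; exact Measure.AbsolutelyContinuous.rfl.add_right _
  set p₁ : ℝ → ℝ := fun s => (m₁.rnDeriv ν s).toReal with hp₁
  set p₂ : ℝ → ℝ := fun s => (m₂.rnDeriv ν s).toReal with hp₂
  have hg₁ : Integrable g₁ m₁ := h₁.integrableOn subset_rfl
  have hg₂ : Integrable g₂ m₂ := h₂.integrableOn subset_rfl
  have hi₁ : Integrable (fun s => p₁ s • g₁ s) ν := (integrable_rnDeriv_smul_iff ac₁).2 hg₁
  have hi₂ : Integrable (fun s => p₂ s • g₂ s) ν := (integrable_rnDeriv_smul_iff ac₂).2 hg₂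
  have hin₁ : Integrable (fun s => p₁ s • ‖g₁ s‖) ν :=
    (integrable_rnDeriv_smul_iff ac₁).2 hg₁.norm
  have hin₂ : Integrable (fun s => p₂ s • ‖g₂ s‖) ν :=
    (integrable_rnDeriv_smul_iff ac₂).2 hg₂.norm
  set G : ℝ → E := fun s => p₁ s • g₁ s - p₂ s • g₂ s with hG
  have hGi : Integrable G ν := hi₁.sub hi₂
  have hpart : ∀ s ∈ Icc 0 t, ∫ r in Iic s, G r ∂ν =
      (y₁ s - y₂ s) - (x₁ s - x₂ s) := by
    intro s hs
    have hsub : Iic s ∩ Icc 0 t = Icc 0 s := by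
      ext r; simp only [mem_inter_iff, mem_Iic, mem_Icc]
      constructor
      · rintro ⟨a, b, c⟩; exact ⟨b, a⟩
      · rintro ⟨a, b⟩; exact ⟨b, a, b.trans hs.2⟩
    have key : ∀ {m : Measure ℝ} [IsFiniteMeasure m] {g : ℝ → E}, m ≪ ν → Integrable g m →
        ∫ r in Iic s, (m.rnDeriv ν r).toReal • g r ∂ν = ∫ r in Iic s, g r ∂m := by
      intro m _ g hac hg
      rw [← integral_indicator measurableSet_Iic, ← integral_indicator measurableSet_Iic,
        ← integral_rnDeriv_smul hac]
      congr 1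
      ext1 r
      by_cases hr : r ∈ Iic s <;> simp [hr]
    rw [integral_sub hi₁.integrableOn hi₂.integrableOn, key ac₁ hg₁, key ac₂ hg₂,
      hm₁, hm₂, Measure.restrict_restrict measurableSet_Iic,
      Measure.restrict_restrict measurableSet_Iic, hsub, h₁.eq s hs.1, h₂.eq s hs.1]
    abel
  have htot : ∫ r, G r ∂ν = (y₁ t - y₂ t) - (x₁ t - x₂ t) := by
    rw [integral_sub hi₁ hi₂, integral_rnDeriv_smul ac₁, integral_rnDeriv_smul ac₂,
      h₁.eq t ht, h₂.eq t ht]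
    abel
  obtain ⟨hE, hle⟩ := norm_integral_sq_le hGi
  have hsupp : ∀ᵐ s ∂ν, s ∈ Icc 0 t := by
    rw [hν, ae_add_measure_iff]
    exact ⟨ae_restrict_mem measurableSet_Icc, ae_restrict_mem measurableSet_Icc⟩
  have hb : ∫ s, ⟪∫ r in Iic s, G r ∂ν, G s⟫_ℝ ∂ν ≤
      ∫ s, δ * (p₁ s • ‖g₁ s‖ + p₂ s • ‖g₂ s‖) ∂ν := by
    refine integral_mono_ae hE ((hin₁.add hin₂).const_mul δ) ?_
    filter_upwards [hsupp] with s hs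
    rw [hpart s hs, inner_sub_left]
    have q₁ : 0 ≤ p₁ s := ENNReal.toReal_nonneg
    have q₂ : 0 ≤ p₂ s := ENNReal.toReal_nonneg
    have e₁ := h₁.normal s hs.1 (x₂ s) (h₂.mem s hs.1)
    have e₂ := h₂.normal s hs.1 (x₁ s) (h₁.mem s hs.1)
    have e₃ : 0 ≤ ⟪x₁ s - x₂ s, G s⟫_ℝ := by
      have a : ⟪x₁ s - x₂ s, G s⟫_ℝ =
          p₁ s * -⟪g₁ s, x₂ s - x₁ s⟫_ℝ + p₂ s * -⟪g₂ s, x₁ s - x₂ s⟫_ℝ := by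
        rw [real_inner_comm]
        simp only [G, inner_sub_left, inner_sub_right, real_inner_smul_left]
        ring
      rw [a]
      have := mul_nonneg q₁ (neg_nonneg.2 e₁)
      have := mul_nonneg q₂ (neg_nonneg.2 e₂)
      linarith
    have e₄ : ⟪y₁ s - y₂ s, G s⟫_ℝ ≤ δ * (p₁ s • ‖g₁ s‖ + p₂ s • ‖g₂ s‖) := by
      refine (real_inner_le_norm _ _).trans ?_
      refine mul_le_mul (hδ s hs) ?_ (norm_nonneg _) ((norm_nonneg _).trans (hδ s hs))
      refine (norm_sub_le _ _).trans ?_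
      rw [norm_smul, norm_smul, Real.norm_of_nonneg q₁, Real.norm_of_nonneg q₂]
      rfl
    linarith
  rw [integral_const_mul, integral_add hin₁ hin₂, integral_rnDeriv_smul ac₁,
    integral_rnDeriv_smul ac₂] at hb
  rw [htot] at hle
  set D := y₁ t - y₂ t
  set z := x₁ t - x₂ t
  set V := ∫ s, ‖g₁ s‖ ∂m₁ + ∫ s, ‖g₂ s‖ ∂m₂ with hV
  have hDδ : ‖D‖ ≤ δ := hδ t ⟨ht, le_rfl⟩
  have hδ0 : 0 ≤ δ := (norm_nonneg _).trans hDδ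
  have hFV : ‖D - z‖ ≤ V := by
    rw [← htot, integral_sub hi₁ hi₂, integral_rnDeriv_smul ac₁, integral_rnDeriv_smul ac₂]
    exact (norm_sub_le _ _).trans
      (add_le_add (norm_integral_le_integral_norm _) (norm_integral_le_integral_norm _))
  have hz : ‖z‖ ^ 2 = ‖D‖ ^ 2 - 2 * ⟪D, D - z⟫_ℝ + ‖D - z‖ ^ 2 := by
    rw [← norm_sub_sq_real, sub_sub_cancel]
  have hin : -⟪D, D - z⟫_ℝ ≤ δ * V := by
    refine (neg_le_abs _).trans ((abs_real_inner_le_norm _ _).trans ?_)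
    exact mul_le_mul hDδ hFV (norm_nonneg _) hδ0
  have : ‖D‖ ^ 2 ≤ δ ^ 2 := pow_le_pow_left₀ (norm_nonneg _) hDδ 2
  nlinarith

theorem IsSkorokhodSolution.exists_isReflection {K : Set E} {y x : ℝ → E}
    (h : IsSkorokhodSolution K y x) : ∃ ν g, IsReflection K y x ν g := by
  obtain ⟨hmem, v, μ, hv, hfin, hnorm, hnormal, -, heq⟩ := h
  refine ⟨μ, v, hmem, hv, fun s => ?_, fun T => ?_, hnormal, heq⟩
  · rcases hnorm s with h | h <;> simp [h]
  · refine (measure_mono ?_).trans_lt (hfin (|T| + 1) (by positivity))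
    exact fun s hs => ⟨hs.1, by linarith [hs.2, le_abs_self T]⟩

theorem IsReflection.eq_of_isReflection {K : Set E} {y x₁ g₁ x₂ g₂ : ℝ → E} {ν₁ ν₂ : Measure ℝ}
    (h₁ : IsReflection K y x₁ ν₁ g₁) (h₂ : IsReflection K y x₂ ν₂ g₂) {t : ℝ} (ht : 0 ≤ t) :
    x₁ t = x₂ t := by
  have := h₁.norm_sub_sq_le h₂ ht (δ := 0) (fun s _ => by simp)
  rw [← sub_eq_zero, ← norm_eq_zero]
  have h0 := norm_nonneg (x₁ t - x₂ t)
  nlinarith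

theorem RCLL.induction {f : ℝ → E} (hf : RCLL f) {ε : ℝ} (hε : 0 < ε) {a : ℝ} (ha : 0 ≤ a)
    {P : ℝ → Prop} (h0 : P a)
    (step : ∀ s t, a ≤ s → s < t → (∀ u ∈ Ico s t, ‖f u - f s‖ ≤ ε) → P s → P t)
    {t : ℝ} (hat : a ≤ t) : P t := by
  by_contra hPt
  set S : Set ℝ := {s | a ≤ s ∧ s ≤ t ∧ P s} with hS
  have haS : a ∈ S := ⟨le_rfl, hat, h0⟩
  have hbdd : BddAbove S := ⟨t, fun s hs => hs.2.1⟩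
  set c := sSup S with hc
  have hac : a ≤ c := le_csSup hbdd haS
  have hct : c ≤ t := csSup_le ⟨a, haS⟩ fun s hs => hs.2.1
  have hPc : P c := by
    rcases hac.eq_or_lt with h | h
    · exact h ▸ h0
    obtain ⟨L, hL⟩ := hf.2 c (ha.trans_lt h)
    have hev : ∀ᶠ u in nhdsWithin c (Iio c), ‖f u - L‖ < ε / 2 := by
      have := (Metric.tendsto_nhds.1 hL) (ε / 2) (half_pos hε)
      simpa only [dist_eq_norm] using this
    obtain ⟨l, hl, hlc⟩ := (mem_nhdsLT_iff_exists_Ioo_subset' (show c - 1 < c by linarith)).1 hev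
    obtain ⟨s, hsS, hls⟩ := exists_lt_of_lt_csSup ⟨a, haS⟩ (show l < sSup S from hl)
    rcases (le_csSup hbdd hsS : s ≤ c).eq_or_lt with h' | h'
    · exact (show s = c from h') ▸ hsS.2.2
    refine step s c hsS.1 h' (fun u hu => ?_) hsS.2.2
    have h1 : ‖f u - L‖ < ε / 2 := hlc ⟨hls.trans_le hu.1, hu.2⟩
    have h2 : ‖f s - L‖ < ε / 2 := hlc ⟨hls, h'⟩
    calc ‖f u - f s‖ = ‖(f u - L) - (f s - L)‖ := by rw [sub_sub_sub_cancel_right]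
      _ ≤ ‖f u - L‖ + ‖f s - L‖ := norm_sub_le _ _
      _ ≤ ε := by linarith
  have hlt : c < t := hct.lt_of_ne fun h => hPt (h ▸ hPc)
  have hev : ∀ᶠ u in nhdsWithin c (Ici c), ‖f u - f c‖ < ε := by
    have := (Metric.tendsto_nhds.1 (hf.1 c (ha.trans hac))) ε hε
    simpa only [dist_eq_norm] using this
  obtain ⟨d, hd, hcd⟩ := (mem_nhdsGE_iff_exists_Ico_subset' hlt).1 hev
  have hcm : c < min d t := lt_min hd hlt
  have hPm : P (min d t) := step c _ hac hcm
    (fun u hu => (show ‖f u - f c‖ < ε from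
      hcd ⟨hu.1, hu.2.trans_le (min_le_left _ _)⟩).le) hPc
  have : min d t ≤ c := le_csSup hbdd ⟨hac.trans hcm.le, min_le_right _ _, hPm⟩
  exact this.not_gt hcm

theorem exists_sub_mem_normalCone {K : Set E} (hne : K.Nonempty) (hcl : IsClosed K)
    (hconv : Convex ℝ K) (q : E) : ∃ p ∈ K, q - p ∈ normalCone K p := by
  obtain ⟨p, hp, h⟩ := exists_norm_eq_iInf_of_complete_convex hne hcl.isComplete hconv q
  exact ⟨p, hp, (norm_eq_iInf_iff_real_inner_le_zero hconv hp).1 h⟩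

theorem smul_mem_normalCone {K : Set E} {x w : E} (hw : w ∈ normalCone K x) {c : ℝ}
    (hc : 0 ≤ c) : c • w ∈ normalCone K x := fun y hy => by
  rw [real_inner_smul_left]
  exact mul_nonpos_of_nonneg_of_nonpos hc (hw y hy)

theorem IsReflection.exists_append_jump {K : Set E} (hne : K.Nonempty) (hcl : IsClosed K)
    (hconv : Convex ℝ K) {y x g : ℝ → E} {ν : Measure ℝ} (h : IsReflection K y x ν g)
    {s t : ℝ} (hs : 0 ≤ s) (hst : s < t) (hν : ν (Ioi s) = 0) (hx : ∀ u, s ≤ u → x u = x s)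
    (hy : ∀ u, s ≤ u → y u = y s) (c : E) :
    ∃ (p : E) (ν' : Measure ℝ) (g' : ℝ → E),
      IsReflection K (fun u => if u < t then y u else c) (fun u => if u < t then x u else p) ν' g'
        ∧ ν' (Ioi t) = 0 := by
  set q := x s + c - y s with hq
  obtain ⟨p, hp, hpn⟩ := exists_sub_mem_normalCone hne hcl hconv q
  set w := ‖q - p‖⁻¹ • (q - p) with hw
  have hwn : w ∈ normalCone K p := smul_mem_normalCone hpn (by positivity)
  have hw1 : ‖w‖ ≤ 1 := by
    rw [hw, norm_smul, norm_inv, norm_norm]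
    exact inv_mul_le_one
  set g' : ℝ → E := fun u => if u < t then g u else w with hg'
  have hg'm : Measurable g' := Measurable.ite measurableSet_Iio h.measurable measurable_const
  set ν' := ν + ENNReal.ofReal ‖q - p‖ • Measure.dirac t with hν'
  have hfin : ∀ T, ν' (Icc 0 T) < ⊤ := fun T => by
    simp only [hν', Measure.add_apply, Measure.smul_apply, smul_eq_mul]
    exact ENNReal.add_lt_top.2 ⟨h.finite T, ENNReal.mul_lt_top ENNReal.ofReal_lt_top
      (measure_lt_top _ _)⟩
  have hgg : g' =ᵐ[ν] g := by
    have : ∀ᵐ u ∂ν, u ∉ Ioi s := measure_eq_zero_iff_ae_notMem.1 hν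
    filter_upwards [this] with u hu
    simp only [mem_Ioi, not_lt] at hu
    simp [hg', hu.trans_lt hst]
  have hint : ∀ u, 0 ≤ u → ∫ r in Icc 0 u, g' r ∂ν' =
      ∫ r in Icc 0 u, g r ∂ν + if u < t then 0 else q - p := by
    intro u hu
    have i₁ : Integrable g' (ν.restrict (Icc 0 u)) :=
      (h.integrableOn subset_rfl : IntegrableOn g (Icc 0 u) ν).congr (ae_restrict_of_ae hgg.symm)
    have i₂ : Integrable g' ((ENNReal.ofReal ‖q - p‖ • Measure.dirac t).restrict (Icc 0 u)) := by
      refine Integrable.restrict ?_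
      refine Integrable.smul_measure ?_ ENNReal.ofReal_ne_top
      exact integrable_dirac (by simp)
    rw [hν', Measure.restrict_add, integral_add_measure i₁ i₂,
      integral_congr_ae (ae_restrict_of_ae hgg)]
    congr 1
    rw [Measure.restrict_smul, integral_smul_measure, ENNReal.toReal_ofReal (norm_nonneg _),
      setIntegral_dirac]
    by_cases hut : u < t
    · simp [hut]
    · have : t ∈ Icc 0 u := ⟨hs.trans hst.le, not_lt.1 hut⟩
      simp only [this, if_true, hut, if_false, hg', lt_irrefl, hw, smul_smul]
      by_cases h0 : ‖q - p‖ = 0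
      · simp [norm_eq_zero.1 h0]
      · rw [mul_inv_cancel₀ h0, one_smul]
  refine ⟨p, ν', g', ⟨?_, hg'm, ?_, hfin, ?_, ?_⟩, ?_⟩
  · intro u hu
    split_ifs
    exacts [h.mem u hu, hp]
  · intro u
    simp only [hg']
    split_ifs
    exacts [h.norm_le u, hw1]
  · intro u hu
    simp only [hg']
    split_ifs
    exacts [h.normal u hu, hwn]
  · intro u hu
    rw [hint u hu]
    split_ifs with hut
    · rw [add_zero, h.eq u hu]
    · have hsu : s ≤ u := hst.le.trans (not_lt.1 hut)
      have := h.eq u hu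
      rw [hx u hsu, hy u hsu] at this
      have hqc : q = c - ∫ r in Icc 0 u, g r ∂ν := by rw [hq, this]; abel
      rw [hqc]
      abel
  · have : ν (Ioi t) = 0 := measure_mono_null (Ioi_subset_Ioi hst.le) hν
    simp [hν', this]

theorem RCLL.exists_isReflection_approx {K : Set E} (hcl : IsClosed K)
    (hconv : Convex ℝ K) {y : ℝ → E} (hy : RCLL y) (hy0 : y 0 ∈ K) {ε : ℝ} (hε : 0 < ε)
    {T : ℝ} (hT : 0 ≤ T) :
    ∃ (y' x : ℝ → E) (ν : Measure ℝ) (g : ℝ → E), IsReflection K y' x ν g ∧ Measurable x ∧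
      (∀ t ≤ 0, x t = y 0 ∧ y' t = y 0) ∧ (∀ s ∈ Icc 0 T, ‖y' s - y s‖ ≤ ε) := by
  suffices ∃ (y' x : ℝ → E) (ν : Measure ℝ) (g : ℝ → E), IsReflection K y' x ν g ∧ Measurable x ∧
      (∀ t ≤ 0, x t = y 0 ∧ y' t = y 0) ∧ (∀ s ∈ Icc 0 T, ‖y' s - y s‖ ≤ ε) ∧
      ν (Ioi T) = 0 ∧ (∀ u, T ≤ u → x u = x T) ∧ (∀ u, T ≤ u → y' u = y T) by
    obtain ⟨y', x, ν, g, h1, h2, h3, h4, -⟩ := this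
    exact ⟨y', x, ν, g, h1, h2, h3, h4⟩
  refine hy.induction hε le_rfl (P := fun T => ∃ (y' x : ℝ → E) (ν : Measure ℝ) (g : ℝ → E),
      IsReflection K y' x ν g ∧ Measurable x ∧
      (∀ t ≤ 0, x t = y 0 ∧ y' t = y 0) ∧ (∀ s ∈ Icc 0 T, ‖y' s - y s‖ ≤ ε) ∧
      ν (Ioi T) = 0 ∧ (∀ u, T ≤ u → x u = x T) ∧ (∀ u, T ≤ u → y' u = y T)) ?_ ?_ hT
  · refine ⟨fun _ => y 0, fun _ => y 0, 0, fun _ => 0,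
      ⟨fun _ _ => hy0, measurable_const, by simp, by simp, fun _ _ => by simp [normalCone],
        by simp⟩, measurable_const, by simp, ?_, by simp, by simp, by simp⟩
    intro s hs
    rw [Icc_self, mem_singleton_iff] at hs
    simp [hs, hε.le]
  · rintro s t hs hst hosc ⟨y', x, ν, g, h, hxm, hneg, happ, hν, hx, hy'⟩
    have hy's : ∀ u, s ≤ u → y' u = y' s := fun u hu => by rw [hy' u hu, hy' s le_rfl]
    obtain ⟨p, ν', g', h', hν'⟩ := h.exists_append_jump ⟨_, hy0⟩ hcl hconv hs hst hν hx hy's (y t)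
    refine ⟨_, _, ν', g', h', Measurable.ite measurableSet_Iio hxm measurable_const, ?_, ?_, hν',
      ?_, ?_⟩
    · intro u hu
      have : u < t := hu.trans_lt (hs.trans_lt hst)
      simpa [this] using hneg u hu
    · intro u hu
      split_ifs with hut
      · rcases le_or_gt u s with h1 | h1
        · exact happ u ⟨hu.1, h1⟩
        · rw [hy' u h1.le, norm_sub_rev]
          exact hosc u ⟨h1.le, hut⟩
      · have : u = t := le_antisymm hu.2 (not_lt.1 hut)
        simp [this, hε.le]
    · intro u hu
      simp [hu.not_gt]
    · intro u hu
      simp [hu.not_gt]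

theorem mul_norm_le_inner_of_mem_normalCone {K : Set E} {a x w : E} {r : ℝ} (hr : 0 < r)
    (hball : Metric.closedBall a r ⊆ K) (hw : w ∈ normalCone K x) :
    r * ‖w‖ ≤ ⟪w, x - a⟫_ℝ := by
  rcases eq_or_ne w 0 with rfl | h0
  · simp
  have hn : ‖w‖ ≠ 0 := norm_ne_zero_iff.2 h0
  have hmem : a + (r / ‖w‖) • w ∈ K := hball (by
    rw [Metric.mem_closedBall, dist_eq_norm, add_sub_cancel_left, norm_smul, norm_div, norm_norm,
      div_mul_cancel₀ _ hn, Real.norm_of_nonneg hr.le])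
  have := hw _ hmem
  rw [show a + (r / ‖w‖) • w - x = (r / ‖w‖) • w - (x - a) by abel, inner_sub_right,
    real_inner_smul_right, real_inner_self_eq_norm_sq] at this
  have e : r / ‖w‖ * ‖w‖ ^ 2 = r * ‖w‖ := by field_simp
  linarith

theorem IsReflection.setIntegral_Ioc {K : Set E} {y x g : ℝ → E} {ν : Measure ℝ}
    (h : IsReflection K y x ν g) {s u : ℝ} (hs : 0 ≤ s) (hsu : s ≤ u) :
    ∫ r in Ioc s u, g r ∂ν = (y u - y s) - (x u - x s) := by
  have hun : Icc 0 s ∪ Ioc s u = Icc 0 u := Icc_union_Ioc_eq_Icc hs hsu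
  have hd : Disjoint (Icc 0 s) (Ioc s u) :=
    disjoint_left.2 fun r h1 h2 => h1.2.not_gt h2.1
  have := setIntegral_union hd measurableSet_Ioc (h.integrableOn (T := u) (hun ▸ subset_union_left))
    (h.integrableOn (T := u) (hun ▸ subset_union_right))
  rw [hun] at this
  rw [h.eq u (hs.trans hsu), h.eq s hs, this]
  abel

theorem IsReflection.norm_sq_add_le {K : Set E} {y x g : ℝ → E} {ν : Measure ℝ}
    (h : IsReflection K y x ν g) {a : E} {r : ℝ} (hr : 0 < r) (hball : Metric.closedBall a r ⊆ K)
    {s t : ℝ} (hs : 0 ≤ s) (hosc : ∀ u ∈ Ico s t, ‖y u - y s‖ ≤ r / 2) :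
    ‖x s - a - ∫ u in Ioo s t, g u ∂ν‖ ^ 2 + r * ∫ u in Ioo s t, ‖g u‖ ∂ν ≤ ‖x s - a‖ ^ 2 := by
  have hsub : Ioo s t ⊆ Icc 0 t := fun u hu => ⟨hs.trans hu.1.le, hu.2.le⟩
  have hgi : Integrable g (ν.restrict (Ioo s t)) := h.integrableOn hsub
  have : IsFiniteMeasure (ν.restrict (Ioo s t)) :=
    ⟨by simpa using (measure_mono hsub).trans_lt (h.finite t)⟩
  obtain ⟨hE, hle⟩ := norm_integral_sq_le hgi
  have hb : ∫ u in Ioo s t, ⟪∫ v in Iic u, g v ∂(ν.restrict (Ioo s t)), g u⟫_ℝ ∂ν ≤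
      ∫ u in Ioo s t, (⟪x s - a, g u⟫_ℝ - r / 2 * ‖g u‖) ∂ν := by
    refine integral_mono_ae hE ((hgi.const_inner _).sub (hgi.norm.const_mul _)) ?_
    filter_upwards [ae_restrict_mem measurableSet_Ioo] with u hu
    have hset : Iic u ∩ Ioo s t = Ioc s u := by
      ext v; simp only [mem_inter_iff, mem_Iic, mem_Ioo, mem_Ioc]
      constructor
      · rintro ⟨a, b, c⟩; exact ⟨b, a⟩
      · rintro ⟨a, b⟩; exact ⟨b, a, b.trans_lt hu.2⟩
    rw [Measure.restrict_restrict measurableSet_Iic, hset, h.setIntegral_Ioc hs hu.1.le]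
    have e₁ := mul_norm_le_inner_of_mem_normalCone hr hball (h.normal u (hs.trans hu.1.le))
    have e₂ : ⟪y u - y s, g u⟫_ℝ ≤ r / 2 * ‖g u‖ :=
      (real_inner_le_norm _ _).trans
        (mul_le_mul_of_nonneg_right (hosc u ⟨hu.1.le, hu.2⟩) (norm_nonneg _))
    rw [real_inner_comm] at e₁
    rw [show (y u - y s) - (x u - x s) = (y u - y s) - (x u - a) + (x s - a) by abel,
      inner_add_left, inner_sub_left]
    linarith
  rw [integral_sub (hgi.const_inner _) (hgi.norm.const_mul _), integral_inner hgi,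
    integral_const_mul] at hb
  rw [norm_sub_sq_real]
  linarith

theorem norm_le_of_inner_nonneg {p G : E} (h : 0 ≤ ⟪G, p - G⟫_ℝ) : ‖G‖ ≤ ‖p‖ := by
  rw [inner_sub_right, real_inner_self_eq_norm_sq] at h
  have h1 := real_inner_le_norm G p
  by_contra! hlt
  have := norm_nonneg p
  nlinarith

theorem IsReflection.norm_jump_le {K : Set E} {y x g : ℝ → E} {ν : Measure ℝ}
    (h : IsReflection K y x ν g) {a : E} (ha : a ∈ K) {t : ℝ} (ht : 0 ≤ t) {p : E}
    (hp : x t - a = p - ∫ u in {t}, g u ∂ν) :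
    ∫ u in {t}, ‖g u‖ ∂ν ≤ ‖p‖ ∧ ‖x t - a‖ ≤ 2 * ‖p‖ := by
  have hG : ∫ u in {t}, g u ∂ν = ν.real {t} • g t := integral_singleton _ _
  have hG' : ∫ u in {t}, ‖g u‖ ∂ν = ‖∫ u in {t}, g u ∂ν‖ := by
    rw [hG, integral_singleton, norm_smul, Real.norm_of_nonneg measureReal_nonneg, smul_eq_mul]
  have hle : ‖∫ u in {t}, g u ∂ν‖ ≤ ‖p‖ := by
    refine norm_le_of_inner_nonneg ?_
    rw [← hp, hG, real_inner_smul_left, ← neg_sub a, inner_neg_right]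
    exact mul_nonneg measureReal_nonneg (neg_nonneg.2 (h.normal t ht a ha))
  refine ⟨hG' ▸ hle, ?_⟩
  rw [hp]
  exact (norm_sub_le _ _).trans (by linarith)

theorem RCLL.exists_forall_integral_norm_le {K : Set E} {y : ℝ → E} (hy : RCLL y) {a : E} {r : ℝ}
    (hr : 0 < r) (hball : Metric.closedBall a r ⊆ K) {T : ℝ} (hT : 0 ≤ T) :
    ∃ M : ℝ, ∀ (y' x : ℝ → E) (ν : Measure ℝ) (g : ℝ → E), IsReflection K y' x ν g →
      (∀ s ∈ Icc 0 T, ‖y' s - y s‖ ≤ r / 6) → ∫ s in Icc 0 T, ‖g s‖ ∂ν ≤ M := by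
  have ha : a ∈ K := hball (Metric.mem_closedBall_self hr.le)
  suffices ∃ M : ℝ, ∀ (y' x : ℝ → E) (ν : Measure ℝ) (g : ℝ → E), IsReflection K y' x ν g →
      (∀ s ∈ Icc 0 T, ‖y' s - y s‖ ≤ r / 6) →
      ∫ s in Icc 0 T, ‖g s‖ ∂ν ≤ M ∧ ‖x T - a‖ ≤ M by
    obtain ⟨M, hM⟩ := this
    exact ⟨M, fun y' x ν g h hy' => (hM y' x ν g h hy').1⟩
  refine hy.induction (ε := r / 6) (by positivity) le_rfl (P := fun T => ∃ M : ℝ,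
      ∀ (y' x : ℝ → E) (ν : Measure ℝ) (g : ℝ → E), IsReflection K y' x ν g →
      (∀ s ∈ Icc 0 T, ‖y' s - y s‖ ≤ r / 6) →
      ∫ s in Icc 0 T, ‖g s‖ ∂ν ≤ M ∧ ‖x T - a‖ ≤ M) ?_ ?_ hT
  · refine ⟨2 * (‖y 0 - a‖ + r / 6), fun y' x ν g h hy' => ?_⟩
    have h0 : ‖y' 0 - a‖ ≤ ‖y 0 - a‖ + r / 6 := by
      rw [← sub_add_sub_cancel _ (y 0), add_comm]
      exact (norm_add_le _ _).trans (add_le_add le_rfl (hy' 0 (by simp)))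
    have he := h.eq 0 le_rfl
    rw [Icc_self] at he ⊢
    obtain ⟨h1, h2⟩ := h.norm_jump_le ha le_rfl (p := y' 0 - a) (by rw [he]; abel)
    have := norm_nonneg (y' 0 - a)
    exact ⟨by linarith, by linarith⟩
  · rintro s t hs hst hosc ⟨M, hM⟩
    set Q := M + ‖y t - y s‖ + r / 3 with hQ
    refine ⟨|M + M ^ 2 / r + Q| + |2 * Q|, fun y' x ν g h hy' => ?_⟩
    obtain ⟨hV, hX⟩ := hM y' x ν g h fun u hu => hy' u ⟨hu.1, hu.2.trans hst.le⟩
    have hM0 : 0 ≤ M := (norm_nonneg _).trans hX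
    have tri : ∀ u ∈ Icc s t, ‖y' u - y' s‖ ≤ ‖y u - y s‖ + r / 3 := by
      intro u hu
      have e₁ := hy' u ⟨hs.trans hu.1, hu.2⟩
      have e₂ := hy' s ⟨hs, hst.le⟩
      rw [show y' u - y' s = (y' u - y u) + (y u - y s) - (y' s - y s) by abel]
      have := norm_sub_le ((y' u - y u) + (y u - y s)) (y' s - y s)
      have := norm_add_le (y' u - y u) (y u - y s)
      linarith
    have hE := h.norm_sq_add_le hr hball hs (t := t) fun u hu =>
      (tri u ⟨hu.1, hu.2.le⟩).trans (by linarith [hosc u hu])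
    set W := ∫ u in Ioo s t, g u ∂ν with hW
    have hX2 : ‖x s - a‖ ^ 2 ≤ M ^ 2 := pow_le_pow_left₀ (norm_nonneg _) hX 2
    have hv0 : 0 ≤ ∫ u in Ioo s t, ‖g u‖ ∂ν := integral_nonneg fun _ => norm_nonneg _
    have hWM : ‖x s - a - W‖ ≤ M := by
      refine abs_le_of_sq_le_sq' ?_ hM0 |>.2
      nlinarith
    have hVI : ∫ u in Ioo s t, ‖g u‖ ∂ν ≤ M ^ 2 / r := by
      rw [le_div_iff₀ hr]
      nlinarith [sq_nonneg ‖x s - a - W‖]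
    have i₁ : IntegrableOn g (Icc 0 s) ν := h.integrableOn subset_rfl
    have i₂ : IntegrableOn g (Ioo s t) ν :=
      h.integrableOn fun u hu => ⟨hs.trans hu.1.le, hu.2.le⟩
    have i₃ : IntegrableOn g {t} ν :=
      h.integrableOn (T := t) (by simpa using hs.trans hst.le)
    have hu₁ : Ioo s t ∪ {t} = Ioc s t := Ioo_union_right hst
    have hd₁ : Disjoint (Ioo s t) {t} := by simp
    have hu₂ : Icc 0 s ∪ Ioc s t = Icc 0 t := Icc_union_Ioc_eq_Icc hs hst.le
    have hd₂ : Disjoint (Icc 0 s) (Ioc s t) :=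
      disjoint_left.2 fun r h1 h2 => h1.2.not_gt h2.1
    set p := x s - a - W + (y' t - y' s) with hp
    have hpx : x t - a = p - ∫ u in {t}, g u ∂ν := by
      have := h.setIntegral_Ioc hs hst.le
      rw [← hu₁, setIntegral_union hd₁ (measurableSet_singleton t) i₂ i₃, ← hW] at this
      rw [← sub_eq_iff_eq_add'.2 this.symm, hp]
      abel
    have hpQ : ‖p‖ ≤ Q := by
      have := tri t ⟨hst.le, le_rfl⟩
      have := norm_add_le (x s - a - W) (y' t - y' s)
      linarith
    obtain ⟨h1, h2⟩ := h.norm_jump_le ha (hs.trans hst.le) hpx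
    have htot : ∫ u in Icc 0 t, ‖g u‖ ∂ν = ∫ u in Icc 0 s, ‖g u‖ ∂ν +
        (∫ u in Ioo s t, ‖g u‖ ∂ν + ∫ u in {t}, ‖g u‖ ∂ν) := by
      rw [← setIntegral_union hd₁ (measurableSet_singleton t) i₂.norm i₃.norm, hu₁, ← hu₂]
      refine setIntegral_union hd₂ measurableSet_Ioc i₁.norm ?_
      rw [← hu₁]
      exact IntegrableOn.union i₂.norm i₃.norm
    have := le_abs_self (M + M ^ 2 / r + Q)
    have := le_abs_self (2 * Q)
    have := abs_nonneg (M + M ^ 2 / r + Q)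
    have := abs_nonneg (2 * Q)
    exact ⟨by linarith, by linarith⟩

theorem tendsto_setIntegral_Icc_right {ν : Measure ℝ} {g : ℝ → E}
    (hg : ∀ T, IntegrableOn g (Icc 0 T) ν) (t : ℝ) :
    Tendsto (fun u => ∫ s in Icc 0 u, g s ∂ν) (nhdsWithin t (Ici t))
      (nhds (∫ s in Icc 0 t, g s ∂ν)) := by
  have hI : ∀ u, ∫ s in Icc 0 u, g s ∂ν = ∫ s, (Icc 0 u).indicator g s ∂ν := fun u =>
    (integral_indicator measurableSet_Icc).symm
  simp_rw [hI]
  refine tendsto_integral_filter_of_dominated_convergence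
    (fun s => ‖(Icc 0 (t + 1)).indicator g s‖) ?_ ?_ ?_ ?_
  · exact Eventually.of_forall fun u =>
      ((hg u).integrable_indicator measurableSet_Icc).aestronglyMeasurable
  · have : ∀ᶠ u in nhdsWithin t (Ici t), u ∈ Ico t (t + 1) := Ico_mem_nhdsGE (by linarith)
    filter_upwards [this] with u hu
    refine Eventually.of_forall fun s => ?_
    exact norm_indicator_le_of_subset (Icc_subset_Icc_right hu.2.le) _ _
  · exact ((hg _).integrable_indicator measurableSet_Icc).norm
  · refine Eventually.of_forall fun s => ?_
    refine tendsto_const_nhds.congr' ?_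
    rcases le_or_gt s t with h | h
    · filter_upwards [self_mem_nhdsWithin] with u hu
      have hsu : s ≤ u := h.trans hu
      simp [indicator_apply, h, hsu]
    · filter_upwards [Ico_mem_nhdsGE h] with u hu
      simp [h.not_ge, hu.2.not_ge]

theorem tendsto_setIntegral_Icc_left {ν : Measure ℝ} {g : ℝ → E}
    (hg : ∀ T, IntegrableOn g (Icc 0 T) ν) (t : ℝ) :
    Tendsto (fun u => ∫ s in Icc 0 u, g s ∂ν) (nhdsWithin t (Iio t))
      (nhds (∫ s in Ico 0 t, g s ∂ν)) := by
  have hI : ∀ u, ∫ s in Icc 0 u, g s ∂ν = ∫ s, (Icc 0 u).indicator g s ∂ν := fun u =>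
    (integral_indicator measurableSet_Icc).symm
  simp_rw [hI]
  rw [← integral_indicator measurableSet_Ico]
  refine tendsto_integral_filter_of_dominated_convergence
    (fun s => ‖(Icc 0 t).indicator g s‖) ?_ ?_ ?_ ?_
  · exact Eventually.of_forall fun u =>
      ((hg u).integrable_indicator measurableSet_Icc).aestronglyMeasurable
  · filter_upwards [self_mem_nhdsWithin] with u hu
    refine Eventually.of_forall fun s => ?_
    exact norm_indicator_le_of_subset (Icc_subset_Icc_right (le_of_lt hu)) _ _
  · exact ((hg _).integrable_indicator measurableSet_Icc).norm
  · refine Eventually.of_forall fun s => ?_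
    refine tendsto_const_nhds.congr' ?_
    rcases lt_or_ge s t with h | h
    · filter_upwards [Ioo_mem_nhdsLT h] with u hu
      simp [indicator_apply, h, hu.1.le]
    · filter_upwards [self_mem_nhdsWithin] with u hu
      have hsu : u < s := lt_of_lt_of_le hu h
      simp [h.not_gt, hsu.not_ge]

theorem RCLL.sub_setIntegral {y x : ℝ → E} (hy : RCLL y) {ν : Measure ℝ} {g : ℝ → E}
    (hg : ∀ T, IntegrableOn g (Icc 0 T) ν)
    (hx : ∀ t, 0 ≤ t → x t = y t - ∫ s in Icc 0 t, g s ∂ν) : RCLL x := by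
  refine ⟨fun t ht => ?_, fun t ht => ?_⟩
  · have h := (hy.1 t ht).sub (tendsto_setIntegral_Icc_right hg t)
    refine ContinuousWithinAt.congr h (fun u hu => hx u (ht.trans hu)) (hx t ht)
  · obtain ⟨L, hL⟩ := hy.2 t ht
    refine ⟨_, (hL.sub (tendsto_setIntegral_Icc_left hg t)).congr' ?_⟩
    filter_upwards [Ioo_mem_nhdsLT ht] with u hu
    exact (hx u hu.1.le).symm

theorem eVariationOn_setIntegral_le {ν : Measure ℝ} {g : ℝ → E}
    (hg : ∀ T, IntegrableOn g (Icc 0 T) ν) {T : ℝ} (hT : 0 ≤ T) :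
    eVariationOn (fun t => ∫ s in Icc 0 t, g s ∂ν) (Icc 0 T) ≤
      ENNReal.ofReal (∫ s in Icc 0 T, ‖g s‖ ∂ν) := by
  set V : ℝ → ℝ := fun t => ∫ s in Icc 0 t, ‖g s‖ ∂ν with hV
  have hinc : ∀ s u, 0 ≤ s → s ≤ u →
      ‖∫ r in Icc 0 u, g r ∂ν - ∫ r in Icc 0 s, g r ∂ν‖ ≤ V u - V s := by
    intro s u hs hsu
    have hun : Icc 0 s ∪ Ioc s u = Icc 0 u := Icc_union_Ioc_eq_Icc hs hsu
    have hd : Disjoint (Icc 0 s) (Ioc s u) :=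
      disjoint_left.2 fun r h1 h2 => h1.2.not_gt h2.1
    have i₂ : IntegrableOn g (Ioc s u) ν := (hg u).mono_set (hun ▸ subset_union_right)
    have e₁ := setIntegral_union hd measurableSet_Ioc (hg s) i₂
    have e₂ := setIntegral_union hd measurableSet_Ioc (hg s).norm i₂.norm
    rw [hun] at e₁ e₂
    simp only [hV]
    rw [e₁, e₂, add_sub_cancel_left, add_sub_cancel_left]
    exact norm_integral_le_integral_norm _
  have hmono : MonotoneOn V (Icc 0 T) := fun s hs u hu hsu =>
    sub_nonneg.1 ((norm_nonneg _).trans (hinc s u hs.1 hsu))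
  have hle : eVariationOn (fun t => ∫ s in Icc 0 t, g s ∂ν) (Icc 0 T) ≤
      eVariationOn V (Icc 0 T) := by
    refine iSup_mono fun p => Finset.sum_le_sum fun i _ => ?_
    have hi := p.2.2.2 i
    have hi' := p.2.2.2 (i + 1)
    have := hinc _ _ hi.1 (p.2.2.1 (Nat.le_succ i))
    rw [edist_dist, edist_dist, dist_eq_norm, Real.dist_eq]
    exact ENNReal.ofReal_le_ofReal (this.trans (le_abs_self _))
  have hvar := hmono.eVariationOn_eq (a := 0) (b := T) ⟨le_rfl, hT⟩ ⟨hT, le_rfl⟩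
  rw [inter_self] at hvar
  rw [hvar] at hle
  refine hle.trans (ENNReal.ofReal_le_ofReal ?_)
  have : 0 ≤ V 0 := integral_nonneg fun _ => norm_nonneg _
  linarith

/-- Locally uniformly convergent reflected paths with locally bounded total reflection. -/
structure ReflectionApprox (K : Set E) (y x : ℝ → E) (Y X : ℕ → ℝ → E) (ν : ℕ → Measure ℝ)
    (g : ℕ → ℝ → E) : Prop where
  isReflection : ∀ k, IsReflection K (Y k) (X k) (ν k) (g k)
  unif : ∀ T η : ℝ, 0 < η → ∀ᶠ k in atTop, ∀ s ∈ Icc 0 T, ‖Y k s - y s‖ ≤ η ∧ ‖X k s - x s‖ ≤ η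
  bounded : ∀ T : ℝ, ∃ M : ℝ, ∀ᶠ k in atTop, ∫ s in Icc 0 T, ‖g k s‖ ∂(ν k) ≤ M

theorem RCLL.exists_reflectionApprox {K : Set E} (hcl : IsClosed K)
    (hconv : Convex ℝ K) (hint : (interior K).Nonempty) {y : ℝ → E} (hy : RCLL y)
    (hy0 : y 0 ∈ K) : ∃ (x : ℝ → E) (Y X : ℕ → ℝ → E) (ν : ℕ → Measure ℝ) (g : ℕ → ℝ → E),
      ReflectionApprox K y x Y X ν g ∧ Measurable x ∧ x 0 = y 0 ∧ ∀ t, 0 ≤ t → x t ∈ K := by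
  obtain ⟨a, haint⟩ := hint
  obtain ⟨r, hr, hball⟩ := Metric.nhds_basis_closedBall.mem_iff.1 (mem_interior_iff_mem_nhds.1 haint)
  have happ := fun k : ℕ => hy.exists_isReflection_approx hcl hconv hy0
    (ε := 1 / ((k : ℝ) + 1)) (by positivity) (T := k) (by positivity)
  choose Y X ν g hR hXm hneg hY using happ
  have hYu : ∀ T η : ℝ, 0 < η → ∀ᶠ k in atTop, ∀ s ∈ Icc 0 T, ‖Y k s - y s‖ ≤ η := by
    intro T η hη
    have h1 : ∀ᶠ k : ℕ in atTop, T ≤ k := tendsto_natCast_atTop_atTop.eventually_ge_atTop T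
    have h2 : ∀ᶠ k : ℕ in atTop, 1 / ((k : ℝ) + 1) < η :=
      (tendsto_one_div_add_atTop_nhds_zero_nat (𝕜 := ℝ)).eventually_lt_const hη
    filter_upwards [h1, h2] with k hk1 hk2 s hs
    exact (hY k s ⟨hs.1, hs.2.trans hk1⟩).trans hk2.le
  have hM : ∀ T : ℝ, ∃ M : ℝ, ∀ᶠ k in atTop, ∀ t ∈ Icc 0 T,
      ∫ s in Icc 0 t, ‖g k s‖ ∂(ν k) ≤ M := by
    intro T
    obtain ⟨M, hM⟩ := hy.exists_forall_integral_norm_le hr hball (abs_nonneg T)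
    refine ⟨M, ?_⟩
    filter_upwards [hYu |T| (r / 6) (by positivity)] with k hk t ht
    refine le_trans ?_ (hM _ _ _ _ (hR k) hk)
    refine setIntegral_mono_set ((hR k).integrableOn subset_rfl).norm
      (Eventually.of_forall fun _ => norm_nonneg _)
      (Icc_subset_Icc_right (ht.2.trans (le_abs_self T))).eventuallyLE
  have hC : ∀ T η : ℝ, 0 < η → ∃ N, ∀ k ≥ N, ∀ l ≥ N, ∀ s ∈ Icc 0 T, ‖X k s - X l s‖ ≤ η := by
    intro T η hη
    obtain ⟨M, hMk⟩ := hM T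
    set δ := min η (η ^ 2 / (8 * (4 * |M| + η))) / 2 with hδ
    have hδ0 : 0 < δ := by positivity
    obtain ⟨N, hN⟩ := eventually_atTop.1 (hMk.and (hYu T δ hδ0))
    refine ⟨N, fun k hk l hl t ht => ?_⟩
    have hsub := (hR k).norm_sub_sq_le (hR l) ht.1 (δ := 2 * δ) fun s hs => by
      have e₁ := (hN k hk).2 s ⟨hs.1, hs.2.trans ht.2⟩
      have e₂ := (hN l hl).2 s ⟨hs.1, hs.2.trans ht.2⟩
      rw [← sub_sub_sub_cancel_right _ _ (y s)]
      exact (norm_sub_le _ _).trans (by linarith)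
    have m₁ := (hN k hk).1 t ht
    have m₂ := (hN l hl).1 t ht
    have hMa := le_abs_self M
    have d₁ : 2 * δ ≤ η := by
      have := min_le_left η (η ^ 2 / (8 * (4 * |M| + η)))
      linarith
    have d₂ : 2 * δ * (8 * (4 * |M| + η)) ≤ η ^ 2 := by
      rw [← le_div_iff₀ (by positivity)]
      have := min_le_right η (η ^ 2 / (8 * (4 * |M| + η)))
      linarith
    refine abs_le_of_sq_le_sq' ?_ hη.le |>.2
    refine hsub.trans ?_
    have h4 : 4 * (2 * δ) * (∫ s in Icc 0 t, ‖g k s‖ ∂(ν k) + ∫ s in Icc 0 t, ‖g l s‖ ∂(ν l)) ≤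
        4 * (2 * δ) * (2 * |M|) := by
      refine mul_le_mul_of_nonneg_left ?_ (by positivity)
      linarith
    nlinarith [abs_nonneg M]
  have hlim : ∀ t, ∃ L, Tendsto (fun k => X k t) atTop (nhds L) := by
    intro t
    rcases le_or_gt t 0 with ht | ht
    · exact ⟨y 0, by simp [fun k => (hneg k t ht).1]⟩
    · refine cauchySeq_tendsto_of_complete (Metric.cauchySeq_iff.2 fun η hη => ?_)
      obtain ⟨N, hN⟩ := hC t (η / 2) (half_pos hη)
      refine ⟨N, fun k hk l hl => ?_⟩
      rw [dist_eq_norm]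
      exact (hN k hk l hl t ⟨ht.le, le_rfl⟩).trans_lt (half_lt_self hη)
  choose x hx using hlim
  refine ⟨x, Y, X, ν, g, ⟨hR, fun T η hη => ?_, fun T => ?_⟩,
    measurable_of_tendsto_metrizable hXm (tendsto_pi_nhds.2 hx), ?_, ?_⟩
  · obtain ⟨N, hN⟩ := hC T η hη
    filter_upwards [hYu T η hη, eventually_ge_atTop N] with k hk hkN s hs
    refine ⟨hk s hs, ?_⟩
    refine le_of_tendsto ((tendsto_const_nhds.sub (hx s)).norm) ?_
    filter_upwards [eventually_ge_atTop N] with l hl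
    exact hN k hkN l hl s hs
  · obtain ⟨M, hMk⟩ := hM |T|
    refine ⟨M, ?_⟩
    filter_upwards [hMk] with k hk
    refine le_trans ?_ (hk |T| ⟨abs_nonneg T, le_rfl⟩)
    exact setIntegral_mono_set ((hR k).integrableOn subset_rfl).norm
      (Eventually.of_forall fun _ => norm_nonneg _)
      (Icc_subset_Icc_right (le_abs_self T)).eventuallyLE
  · refine tendsto_nhds_unique (hx 0) ?_
    simp [fun k => (hneg k 0 le_rfl).1]
  · exact fun t ht => hcl.mem_of_tendsto (hx t) (Eventually.of_forall fun k => (hR k).mem t ht)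

theorem ReflectionApprox.tendstoUniformly {K : Set E} {y x : ℝ → E} {Y X : ℕ → ℝ → E}
    {ν : ℕ → Measure ℝ} {g : ℕ → ℝ → E} (h : ReflectionApprox K y x Y X ν g) (T : ℝ) {η : ℝ}
    (hη : 0 < η) :
    ∀ᶠ k in atTop, ∀ s ∈ Icc 0 T, ‖∫ r in Icc 0 s, g k r ∂(ν k) - (y s - x s)‖ ≤ η := by
  filter_upwards [h.unif T (η / 2) (half_pos hη)] with k hk s hs
  have : ∫ r in Icc 0 s, g k r ∂(ν k) = Y k s - X k s := by
    rw [(h.isReflection k).eq s hs.1]; abel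
  rw [this, sub_sub_sub_comm]
  exact (norm_sub_le _ _).trans (by linarith [(hk s hs).1, (hk s hs).2])

theorem ReflectionApprox.continuousWithinAt {K : Set E} {y x : ℝ → E} {Y X : ℕ → ℝ → E}
    {ν : ℕ → Measure ℝ} {g : ℕ → ℝ → E} (h : ReflectionApprox K y x Y X ν g) {t : ℝ}
    (ht : 0 ≤ t) : ContinuousWithinAt (fun s => y s - x s) (Ici t) t := by
  refine continuousWithinAt_of_locally_uniform_approx_of_continuousWithinAt self_mem_Ici
    fun U hU => ?_
  obtain ⟨η, hη, hηU⟩ := Metric.mem_uniformity_dist.1 hU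
  obtain ⟨k, hk⟩ := (h.tendstoUniformly (t + 1) (half_pos hη)).exists
  refine ⟨Ico t (t + 1), Ico_mem_nhdsGE (by linarith), fun s => ∫ r in Icc 0 s, g k r ∂(ν k),
    tendsto_setIntegral_Icc_right (fun T => (h.isReflection k).integrableOn subset_rfl) t,
    fun s hs => hηU ?_⟩
  rw [dist_comm, dist_eq_norm]
  exact (hk s ⟨ht.trans hs.1, hs.2.le⟩).trans_lt (half_lt_self hη)

theorem ReflectionApprox.eVariationOn_lt_top {K : Set E} {y x : ℝ → E} {Y X : ℕ → ℝ → E}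
    {ν : ℕ → Measure ℝ} {g : ℕ → ℝ → E} (h : ReflectionApprox K y x Y X ν g) {T : ℝ}
    (hT : 0 ≤ T) : eVariationOn (fun s => y s - x s) (Icc 0 T) < ⊤ := by
  obtain ⟨M, hM⟩ := h.bounded T
  by_contra hlt
  have hlt' : ENNReal.ofReal M < eVariationOn (fun s => y s - x s) (Icc 0 T) := by
    rw [not_lt_top_iff.1 hlt]; exact ENNReal.ofReal_lt_top
  have hlim : ∀ s ∈ Icc 0 T, Tendsto (fun k => ∫ r in Icc 0 s, g k r ∂(ν k)) atTop
      (nhds (y s - x s)) := by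
    intro s hs
    refine Metric.tendsto_nhds.2 fun η hη => ?_
    filter_upwards [h.tendstoUniformly T (half_pos hη)] with k hk
    rw [dist_eq_norm]
    exact (hk s hs).trans_lt (half_lt_self hη)
  have hev := eVariationOn.lowerSemicontinuous_aux
    (F := fun k s => ∫ r in Icc 0 s, g k r ∂(ν k)) hlim hlt'
  obtain ⟨k, hk1, hk2⟩ := (hev.and hM).exists
  have := eVariationOn_setIntegral_le
    (fun T => (h.isReflection k).integrableOn (A := Icc 0 T) subset_rfl) hT
  exact (this.trans (ENNReal.ofReal_le_ofReal hk2)).not_gt hk1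

theorem exists_stieltjes_sub_of_locallyBoundedVariationOn {f : ℝ → ℝ}
    (hf : LocallyBoundedVariationOn f univ) (hr : ∀ t, ContinuousWithinAt f (Ici t) t) :
    ∃ P Q : StieltjesFunction ℝ, ∀ t, f t = P t - Q t := by
  obtain ⟨p, q, hp, hq, rfl⟩ := hf.exists_monotoneOn_sub_monotoneOn
  have hp' := monotoneOn_univ.1 hp
  have hq' := monotoneOn_univ.1 hq
  refine ⟨hp'.stieltjesFunction, hq'.stieltjesFunction, fun t => ?_⟩
  rw [hp'.stieltjesFunction_eq, hq'.stieltjesFunction_eq]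
  exact tendsto_nhds_unique ((hr t).mono_left (nhdsWithin_mono t Ioi_subset_Ici_self))
    ((hp'.tendsto_rightLim t).sub (hq'.tendsto_rightLim t))

theorem exists_density_of_eVariationOn_lt_top {ψ : ℝ → E} (h0 : ψ 0 = 0)
    (hr : ∀ t, 0 ≤ t → ContinuousWithinAt ψ (Ici t) t)
    (hv : ∀ T, 0 ≤ T → eVariationOn ψ (Icc 0 T) < ⊤) :
    ∃ (μ : Measure ℝ) (γ : ℝ → E), IsLocallyFiniteMeasure μ ∧ μ (Iic 0) = 0 ∧ Measurable γ ∧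
      (∀ T, IntegrableOn γ (Icc 0 T) μ) ∧ ∀ t, 0 ≤ t → ψ t = ∫ s in Icc 0 t, γ s ∂μ := by
  have hcoord : ∀ i : Fin n, ∃ P Q : StieltjesFunction ℝ, ∀ t, ψ (max t 0) i = P t - Q t := by
    intro i
    refine exists_stieltjes_sub_of_locallyBoundedVariationOn ?_ fun t => ?_
    · have hlip : LipschitzWith ‖(EuclideanSpace.proj i : E →L[ℝ] ℝ)‖₊ fun v : E => v i :=
        (EuclideanSpace.proj i : E →L[ℝ] ℝ).lipschitz
      refine hlip.comp_locallyBoundedVariationOn (g := fun t => ψ (max t 0)) ?_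
      intro a b _ _
      refine ne_top_of_le_ne_top (hv (max b 0) (le_max_right _ _)).ne ?_
      refine eVariationOn.comp_le_of_monotoneOn ψ (fun t => max t 0)
        (fun s _ t _ hst => max_le_max_right 0 hst) fun t ht => ?_
      exact ⟨le_max_right _ _, max_le_max_right 0 ht.2.2⟩
    · have h1 : ContinuousWithinAt (fun t => ψ (max t 0)) (Ici t) t := by
        refine ContinuousWithinAt.comp (t := Ici (max t 0)) (hr _ (le_max_right _ _))
          (by fun_prop) fun s hs =>
            show max t 0 ≤ max s 0 from max_le_max_right 0 (mem_Ici.1 hs)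
      exact (EuclideanSpace.proj i : E →L[ℝ] ℝ).continuous.continuousAt.comp_continuousWithinAt h1
  choose P Q hPQ using hcoord
  set μ : Measure ℝ := ∑ i, ((P i).measure + (Q i).measure) with hμ
  have hfin : IsLocallyFiniteMeasure μ := by
    refine ⟨fun t => ⟨Ioo (t - 1) (t + 1), Ioo_mem_nhds (by linarith) (by linarith), ?_⟩⟩
    rw [hμ, Measure.finsetSum_apply]
    exact ENNReal.sum_lt_top.2 fun i _ => by
      rw [Measure.add_apply]
      exact ENNReal.add_lt_top.2 ⟨measure_Ioo_lt_top, measure_Ioo_lt_top⟩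
  have hacP : ∀ i, (P i).measure ≪ μ := fun i =>
    ((Measure.le_add_right le_rfl).trans
      (Finset.single_le_sum (f := fun i => (P i).measure + (Q i).measure)
        (fun _ _ => Measure.zero_le _) (Finset.mem_univ i))).absolutelyContinuous
  have hacQ : ∀ i, (Q i).measure ≪ μ := fun i =>
    ((Measure.le_add_left le_rfl).trans
      (Finset.single_le_sum (f := fun i => (P i).measure + (Q i).measure)
        (fun _ _ => Measure.zero_le _) (Finset.mem_univ i))).absolutelyContinuous
  set d : Fin n → ℝ → ℝ := fun i s =>
    ((P i).measure.rnDeriv μ s).toReal - ((Q i).measure.rnDeriv μ s).toReal with hd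
  have hdm : ∀ i, Measurable (d i) := fun i =>
    (Measure.measurable_rnDeriv _ _).ennreal_toReal.sub
      (Measure.measurable_rnDeriv _ _).ennreal_toReal
  have hPi : ∀ i t, IntegrableOn (fun s => ((P i).measure.rnDeriv μ s).toReal) (Ioc 0 t) μ :=
    fun i t => Measure.integrableOn_toReal_rnDeriv measure_Ioc_lt_top.ne
  have hQi : ∀ i t, IntegrableOn (fun s => ((Q i).measure.rnDeriv μ s).toReal) (Ioc 0 t) μ :=
    fun i t => Measure.integrableOn_toReal_rnDeriv measure_Ioc_lt_top.ne
  have hdi : ∀ i t, IntegrableOn (d i) (Ioc 0 t) μ := fun i t => (hPi i t).sub (hQi i t)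
  have hdint : ∀ i t, 0 ≤ t → ∫ s in Ioc 0 t, d i s ∂μ = ψ t i := by
    intro i t ht
    rw [integral_sub (hPi i t) (hQi i t), Measure.setIntegral_toReal_rnDeriv (hacP i),
      Measure.setIntegral_toReal_rnDeriv (hacQ i), measureReal_def, measureReal_def,
      StieltjesFunction.measure_Ioc, StieltjesFunction.measure_Ioc,
      ENNReal.toReal_ofReal (sub_nonneg.2 ((P i).mono ht)),
      ENNReal.toReal_ofReal (sub_nonneg.2 ((Q i).mono ht))]
    have e₁ := hPQ i t
    have e₂ := hPQ i 0
    rw [max_eq_left ht] at e₁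
    rw [max_self, h0] at e₂
    simp only [PiLp.zero_apply] at e₂
    linarith
  set b := EuclideanSpace.basisFun (Fin n) ℝ
  set γ : ℝ → E := fun s => ∑ i, d i s • b i with hγ
  have hI : ∀ t : ℝ, Icc 0 t ∩ Ioi 0 = Ioc 0 t := by
    intro t; ext s
    simp only [mem_inter_iff, mem_Icc, mem_Ioi, mem_Ioc]
    exact ⟨fun h => ⟨h.2, h.1.2⟩, fun h => ⟨⟨h.1.le, h.2⟩, h.1⟩⟩
  have hres : ∀ t : ℝ, (μ.restrict (Ioi 0)).restrict (Icc 0 t) = μ.restrict (Ioc 0 t) := fun t => by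
    rw [Measure.restrict_restrict measurableSet_Icc, hI]
  refine ⟨μ.restrict (Ioi 0), γ, inferInstance, ?_, ?_, fun T => ?_, fun t ht => ?_⟩
  · rw [Measure.restrict_apply measurableSet_Iic, Iic_inter_Ioi, Ioc_self, measure_empty]
  · exact Finset.measurable_sum _ fun i _ => (hdm i).smul_const _
  · rw [IntegrableOn, hres]
    exact integrable_finsetSum _ fun i _ => (hdi i T).smul_const _
  · rw [hres, hγ, integral_finsetSum _ fun i _ => (hdi i t).smul_const _]
    simp_rw [integral_smul_const, hdint _ t ht]
    conv_lhs => rw [← b.sum_repr (ψ t)]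
    rfl

theorem RCLL.exists_norm_le {f : ℝ → E} (hf : RCLL f) {T : ℝ} (hT : 0 ≤ T) :
    ∃ C : ℝ, ∀ u ∈ Icc 0 T, ‖f u‖ ≤ C := by
  refine hf.induction one_pos le_rfl (P := fun T => ∃ C : ℝ, ∀ u ∈ Icc 0 T, ‖f u‖ ≤ C) ?_ ?_ hT
  · refine ⟨‖f 0‖, fun u hu => ?_⟩
    rw [Icc_self, mem_singleton_iff] at hu
    rw [hu]
  · rintro s t hs hst hosc ⟨C, hC⟩
    refine ⟨max (C + 1) ‖f t‖, fun u hu => ?_⟩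
    rcases le_or_gt u s with h | h
    · exact (hC u ⟨hu.1, h⟩).trans ((by linarith : C ≤ C + 1).trans (le_max_left _ _))
    rcases hu.2.eq_or_lt with h' | h'
    · rw [h']; exact le_max_right _ _
    · refine le_trans ?_ (le_max_left _ _)
      rw [← sub_add_cancel (f u) (f s)]
      refine (norm_add_le _ _).trans ?_
      linarith [hosc u ⟨h.le, h'⟩, hC s ⟨hs, le_rfl⟩]

theorem ae_nonpos_of_setIntegral_Icc_nonpos {μ : Measure ℝ} [IsLocallyFiniteMeasure μ]
    (h0 : μ (Iic 0) = 0) {f : ℝ → ℝ} (hf : LocallyIntegrable f μ)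
    (h : ∀ s t, 0 ≤ s → s ≤ t → ∫ u in Icc s t, f u ∂μ ≤ 0) : ∀ᵐ u ∂μ, f u ≤ 0 := by
  have hpos : ∀ᵐ u ∂μ, u ∉ Iic (0 : ℝ) := measure_eq_zero_iff_ae_notMem.1 h0
  filter_upwards [hpos, (Besicovitch.vitaliFamily μ).ae_tendsto_average hf] with u hu hlim
  have hu0 : 0 < u := not_le.1 hu
  refine le_of_tendsto (hlim.comp (Besicovitch.tendsto_filterAt μ u)) ?_
  filter_upwards [Ioc_mem_nhdsGT hu0] with r hr
  simp only [Function.comp_apply]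
  rw [Real.closedBall_eq_Icc, setAverage_eq, smul_eq_mul]
  exact mul_nonpos_of_nonneg_of_nonpos (inv_nonneg.2 measureReal_nonneg)
    (h _ _ (by linarith [hr.2]) (by linarith [hr.1]))

theorem ReflectionApprox.tendsto_setIntegral_Ico {K : Set E} {y x : ℝ → E} {Y X : ℕ → ℝ → E}
    {ν : ℕ → Measure ℝ} {g : ℕ → ℝ → E} (h : ReflectionApprox K y x Y X ν g) {μ : Measure ℝ}
    {γ : ℝ → E} (hγ : ∀ T, IntegrableOn γ (Icc 0 T) μ)
    (hxy : ∀ t, 0 ≤ t → y t - x t = ∫ s in Icc 0 t, γ s ∂μ) {a b : ℝ} (ha : 0 ≤ a) (hab : a ≤ b) :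
    Tendsto (fun k => ∫ r in Ico a b, g k r ∂(ν k)) atTop (nhds (∫ r in Ico a b, γ r ∂μ)) := by
  have hg : ∀ k T, IntegrableOn (g k) (Icc 0 T) (ν k) :=
    fun k T => (h.isReflection k).integrableOn subset_rfl
  have key : ∀ c, 0 ≤ c → Tendsto (fun k => ∫ r in Ico 0 c, g k r ∂(ν k)) atTop
      (nhds (∫ r in Ico 0 c, γ r ∂μ)) := by
    intro c hc
    rcases hc.eq_or_lt with rfl | hc
    · simp
    refine Metric.tendsto_nhds.2 fun η hη => ?_
    filter_upwards [h.tendstoUniformly c (half_pos hη)] with k hk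
    rw [dist_eq_norm]
    refine lt_of_le_of_lt ?_ (half_lt_self hη)
    refine le_of_tendsto ((tendsto_setIntegral_Icc_left (hg k) c).sub
      (tendsto_setIntegral_Icc_left hγ c)).norm ?_
    filter_upwards [Ioo_mem_nhdsLT hc] with u hu
    rw [← hxy u hu.1.le]
    exact hk u ⟨hu.1.le, hu.2.le⟩
  have hun : Ico 0 a ∪ Ico a b = Ico 0 b := Ico_union_Ico_eq_Ico ha hab
  have hd : Disjoint (Ico 0 a) (Ico a b) :=
    disjoint_left.2 fun r h1 h2 => h1.2.not_ge h2.1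
  have hsplit : ∀ {m : Measure ℝ} {f : ℝ → E}, (∀ T, IntegrableOn f (Icc 0 T) m) →
      ∫ r in Ico a b, f r ∂m = ∫ r in Ico 0 b, f r ∂m - ∫ r in Ico 0 a, f r ∂m := by
    intro m f hf
    rw [← hun, setIntegral_union hd measurableSet_Ico ((hf a).mono_set Ico_subset_Icc_self)
      ((hf b).mono_set fun r hr => ⟨ha.trans hr.1, hr.2.le⟩), add_sub_cancel_left]
  simp_rw [hsplit hγ, fun k => hsplit (hg k)]
  exact (key b (ha.trans hab)).sub (key a ha)

theorem integrableOn_inner_sub {x γ : ℝ → E} (hx : RCLL x) (hxm : Measurable x) {μ : Measure ℝ}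
    (hγ : ∀ T, IntegrableOn γ (Icc 0 T) μ) (z : E) (T : ℝ) :
    IntegrableOn (fun u => ⟪γ u, z - x u⟫_ℝ) (Icc 0 T) μ := by
  obtain ⟨C, hC⟩ := hx.exists_norm_le (abs_nonneg T)
  refine Integrable.mono' (g := fun u => (‖z‖ + C) * ‖γ u‖) ((hγ T).norm.const_mul _) ?_ ?_
  · exact (hγ T).aestronglyMeasurable.inner (measurable_const.sub hxm).aestronglyMeasurable
  · filter_upwards [ae_restrict_mem measurableSet_Icc] with u hu
    refine (norm_inner_le_norm _ _).trans ?_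
    rw [mul_comm]
    refine mul_le_mul_of_nonneg_right ?_ (norm_nonneg _)
    exact (norm_sub_le _ _).trans
      (add_le_add le_rfl (hC u ⟨hu.1, hu.2.trans (le_abs_self T)⟩))

theorem ReflectionApprox.setIntegral_Ico_nonpos {K : Set E} {y x : ℝ → E} {Y X : ℕ → ℝ → E}
    {ν : ℕ → Measure ℝ} {g : ℕ → ℝ → E} (h : ReflectionApprox K y x Y X ν g) (hx : RCLL x)
    (hxm : Measurable x) {μ : Measure ℝ} {γ : ℝ → E} (hγ : ∀ T, IntegrableOn γ (Icc 0 T) μ)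
    (hxy : ∀ t, 0 ≤ t → y t - x t = ∫ s in Icc 0 t, γ s ∂μ) {z : E} (hz : z ∈ K) {s t : ℝ}
    (hs : 0 ≤ s) (hst : s ≤ t) : ∫ u in Ico s t, ⟪γ u, z - x u⟫_ℝ ∂μ ≤ 0 := by
  have hf := integrableOn_inner_sub hx hxm hγ z
  have hg : ∀ k T, IntegrableOn (g k) (Icc 0 T) (ν k) :=
    fun k T => (h.isReflection k).integrableOn subset_rfl
  have hsub : ∀ a b : ℝ, 0 ≤ a → Ico a b ⊆ Icc 0 b := fun a b ha r hr => ⟨ha.trans hr.1, hr.2.le⟩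
  have hadd : ∀ {F : Type} [NormedAddCommGroup F] [NormedSpace ℝ F] {m : Measure ℝ} {f : ℝ → F},
      (∀ T, IntegrableOn f (Icc 0 T) m) → ∀ {a b : ℝ}, s ≤ a → a ≤ b →
      ∫ r in Ico s b, f r ∂m = ∫ r in Ico s a, f r ∂m + ∫ r in Ico a b, f r ∂m := by
    intro F _ _ m f hf a b hsa hab
    rw [← Ico_union_Ico_eq_Ico hsa hab]
    exact setIntegral_union (disjoint_left.2 fun r h1 h2 => h1.2.not_ge h2.1) measurableSet_Ico
      ((hf a).mono_set (hsub s a hs)) ((hf b).mono_set (hsub a b (hs.trans hsa)))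
  have hloc : ∀ ε : ℝ, 0 < ε → ∀ η : ℝ, 0 < η → ∀ᶠ k in atTop,
      ∫ u in Ico s t, ⟪γ u, z - x u⟫_ℝ ∂μ ≤ ε * ∫ u in Ico s t, ‖γ u‖ ∂μ +
        2 * ε * ∫ u in Ico s t, ‖g k u‖ ∂(ν k) + η := by
    intro ε hε
    refine hx.induction hε hs (P := fun b => ∀ η : ℝ, 0 < η → ∀ᶠ k in atTop,
      ∫ u in Ico s b, ⟪γ u, z - x u⟫_ℝ ∂μ ≤ ε * ∫ u in Ico s b, ‖γ u‖ ∂μ +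
        2 * ε * ∫ u in Ico s b, ‖g k u‖ ∂(ν k) + η) ?_ ?_ hst
    · intro η hη
      simp [hη.le]
    · intro a b hsa hab hosc hind η hη
      have ha : 0 ≤ a := hs.trans hsa
      have hγab : IntegrableOn γ (Ico a b) μ := (hγ b).mono_set (hsub a b ha)
      have hfab : ∫ u in Ico a b, ⟪γ u, z - x u⟫_ℝ ∂μ ≤
          ⟪z - x a, ∫ u in Ico a b, γ u ∂μ⟫_ℝ + ε * ∫ u in Ico a b, ‖γ u‖ ∂μ := by
        rw [← integral_inner hγab, ← integral_const_mul,
          ← integral_add (hγab.const_inner _) (hγab.norm.const_mul _)]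
        refine setIntegral_mono_on ((hf b).mono_set (hsub a b ha))
          ((hγab.const_inner _).add (hγab.norm.const_mul _)) measurableSet_Ico fun u hu => ?_
        have e : ⟪γ u, z - x u⟫_ℝ = ⟪z - x a, γ u⟫_ℝ - ⟪x u - x a, γ u⟫_ℝ := by
          rw [← inner_sub_left, real_inner_comm]
          congr 1
          abel
        have e' := (neg_le_abs _).trans (abs_real_inner_le_norm (x u - x a) (γ u))
        have := mul_le_mul_of_nonneg_right (hosc u hu) (norm_nonneg (γ u))
        linarith
      have hlim := (tendsto_const_nhds (x := z - x a)).inner (𝕜 := ℝ)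
        (h.tendsto_setIntegral_Ico hγ hxy ha hab.le)
      have hev : ∀ᶠ k in atTop, ⟪z - x a, ∫ u in Ico a b, γ u ∂μ⟫_ℝ - η / 2 <
          ⟪z - x a, ∫ u in Ico a b, g k u ∂(ν k)⟫_ℝ :=
        hlim.eventually_const_lt (by linarith)
      filter_upwards [hind (η / 2) (half_pos hη), hev, h.unif b ε hε] with k hk1 hk2 hk3
      have hgab : IntegrableOn (g k) (Ico a b) (ν k) := (hg k b).mono_set (hsub a b ha)
      have hgk : ⟪z - x a, ∫ u in Ico a b, g k u ∂(ν k)⟫_ℝ ≤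
          2 * ε * ∫ u in Ico a b, ‖g k u‖ ∂(ν k) := by
        rw [← integral_inner hgab, ← integral_const_mul]
        refine setIntegral_mono_on (hgab.const_inner _) (hgab.norm.const_mul _)
          measurableSet_Ico fun u hu => ?_
        have hu0 := ha.trans hu.1
        have e₁ := (h.isReflection k).normal u hu0 z hz
        have e₂ : ⟪z - x a, g k u⟫_ℝ = ⟪g k u, z - X k u⟫_ℝ +
            ⟪(X k u - x u) + (x u - x a), g k u⟫_ℝ := by
          rw [real_inner_comm (z - X k u), ← inner_add_left]
          congr 1
          abel
        have e₃ : ‖(X k u - x u) + (x u - x a)‖ ≤ 2 * ε :=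
          (norm_add_le _ _).trans
            (by linarith [(hk3 u ⟨hu0, hu.2.le⟩).2, hosc u hu])
        have e₄ := (real_inner_le_norm ((X k u - x u) + (x u - x a)) (g k u)).trans
          (mul_le_mul_of_nonneg_right e₃ (norm_nonneg _))
        linarith
      rw [hadd hf hsa hab.le, hadd (fun T => (hγ T).norm) hsa hab.le,
        hadd (fun T => (hg k T).norm) hsa hab.le]
      linarith
  obtain ⟨M, hM⟩ := h.bounded t
  have hbound : ∀ ε : ℝ, 0 < ε → ∫ u in Ico s t, ⟪γ u, z - x u⟫_ℝ ∂μ ≤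
      ε * (∫ u in Ico s t, ‖γ u‖ ∂μ + 2 * M + 1) := by
    intro ε hε
    obtain ⟨k, hk1, hk2⟩ := ((hloc ε hε ε hε).and hM).exists
    have : ∫ u in Ico s t, ‖g k u‖ ∂(ν k) ≤ M :=
      (setIntegral_mono_set (hg k t).norm (Eventually.of_forall fun _ => norm_nonneg _)
        (hsub s t hs).eventuallyLE).trans hk2
    nlinarith
  set c := ∫ u in Ico s t, ‖γ u‖ ∂μ + 2 * M + 1
  refine ge_of_tendsto (f := fun ε : ℝ => ε * c) (x := nhdsWithin 0 (Ioi 0)) ?_ ?_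
  · have : Tendsto (fun ε : ℝ => ε * c) (nhds 0) (nhds (0 * c)) :=
      (continuous_id.mul continuous_const).tendsto 0
    rw [zero_mul] at this
    exact this.mono_left nhdsWithin_le_nhds
  · filter_upwards [self_mem_nhdsWithin] with ε hε
    exact hbound ε hε

theorem ReflectionApprox.ae_mem_normalCone {K : Set E} {y x : ℝ → E} {Y X : ℕ → ℝ → E}
    {ν : ℕ → Measure ℝ} {g : ℕ → ℝ → E} (h : ReflectionApprox K y x Y X ν g) (hx : RCLL x)
    (hxm : Measurable x) {μ : Measure ℝ} [IsLocallyFiniteMeasure μ] (hμ : μ (Iic 0) = 0)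
    {γ : ℝ → E} (hγ : ∀ T, IntegrableOn γ (Icc 0 T) μ)
    (hxy : ∀ t, 0 ≤ t → y t - x t = ∫ s in Icc 0 t, γ s ∂μ) {z : E} (hz : z ∈ K) :
    ∀ᵐ u ∂μ, ⟪γ u, z - x u⟫_ℝ ≤ 0 := by
  have hf := integrableOn_inner_sub hx hxm hγ z
  refine ae_nonpos_of_setIntegral_Icc_nonpos hμ ?_ fun s t hs hst => ?_
  · intro u
    refine ⟨Icc (u - 1) (u + 1), Icc_mem_nhds (by linarith) (by linarith), ?_⟩
    have h1 : IntegrableOn (fun u => ⟪γ u, z - x u⟫_ℝ) (Iic 0) μ := by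
      rw [IntegrableOn, Measure.restrict_eq_zero.2 hμ]
      exact integrable_zero_measure
    refine (IntegrableOn.union h1 (hf (u + 1))).mono_set fun v hv => ?_
    rcases le_or_gt v 0 with h' | h'
    · exact Or.inl h'
    · exact Or.inr ⟨h'.le, hv.2⟩
  · have hinter : ⋂ k : ℕ, Ico s (t + 1 / ((k : ℝ) + 1)) = Icc s t := by
      ext u
      simp only [mem_iInter, mem_Ico, mem_Icc]
      refine ⟨fun hu => ⟨(hu 0).1, ?_⟩, fun hu k => ⟨hu.1, hu.2.trans_lt ?_⟩⟩
      · refine ge_of_tendsto (f := fun k : ℕ => t + 1 / ((k : ℝ) + 1)) (x := atTop) ?_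
          (Eventually.of_forall fun k => (hu k).2.le)
        simpa using tendsto_const_nhds.add (tendsto_one_div_add_atTop_nhds_zero_nat (𝕜 := ℝ))
      · have : 0 < 1 / ((k : ℝ) + 1) := by positivity
        linarith
    rw [← hinter]
    refine le_of_tendsto (tendsto_setIntegral_of_antitone (fun _ => measurableSet_Ico) ?_
      ⟨0, (hf (t + 1 / ((0 : ℕ) + 1 : ℝ))).mono_set fun u hu => ⟨hs.trans hu.1, hu.2.le⟩⟩)
      (Eventually.of_forall fun k => h.setIntegral_Ico_nonpos hx hxm hγ hxy hz hs ?_)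
    · intro k l hkl
      refine Ico_subset_Ico_right (add_le_add le_rfl ?_)
      exact one_div_le_one_div_of_le (by positivity) (by exact_mod_cast Nat.add_le_add_right hkl 1)
    · have : 0 < 1 / ((k : ℝ) + 1) := by positivity
      linarith

theorem eq_zero_of_mem_normalCone_of_mem_interior {K : Set E} {x w : E} (hx : x ∈ interior K)
    (hw : w ∈ normalCone K x) : w = 0 := by
  obtain ⟨r, hr, hball⟩ := Metric.nhds_basis_closedBall.mem_iff.1 (mem_interior_iff_mem_nhds.1 hx)
  have := mul_norm_le_inner_of_mem_normalCone hr hball hw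
  rw [sub_self, inner_zero_right] at this
  have h0 := norm_nonneg w
  exact norm_eq_zero.1 (by nlinarith)

theorem measurableSet_mem_normalCone {K : Set E} {x γ : ℝ → E} (hx : Measurable x)
    (hγ : Measurable γ) {D : Set E} (hD : D.Countable) (hDK : D ⊆ K) (hKD : K ⊆ closure D) :
    {u | γ u ∈ normalCone K (x u)} = ⋂ z ∈ D, {u | ⟪γ u, z - x u⟫_ℝ ≤ 0} ∧
      MeasurableSet {u | γ u ∈ normalCone K (x u)} := by
  have heq : {u | γ u ∈ normalCone K (x u)} = ⋂ z ∈ D, {u | ⟪γ u, z - x u⟫_ℝ ≤ 0} := by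
    ext u
    simp only [mem_iInter]
    refine ⟨fun h z hz => h z (hDK hz), fun h z hz => ?_⟩
    have hcl : IsClosed {z : E | ⟪γ u, z - x u⟫_ℝ ≤ 0} :=
      isClosed_le (by fun_prop) continuous_const
    exact closure_minimal h hcl (hKD hz)
  refine ⟨heq, heq ▸ MeasurableSet.biInter hD fun z _ => ?_⟩
  exact measurableSet_le (hγ.inner (measurable_const.sub hx)) measurable_const

theorem RCLL.exists_isSkorokhodSolution {K : Set E} (hcl : IsClosed K)
    (hconv : Convex ℝ K) (hint : (interior K).Nonempty) {y : ℝ → E} (hy : RCLL y)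
    (hy0 : y 0 ∈ K) : ∃ x, IsSkorokhodSolution K y x ∧ RCLL x := by
  obtain ⟨x, Y, X, ν, g, h, hxm, hx0, hxK⟩ := hy.exists_reflectionApprox hcl hconv hint hy0
  obtain ⟨μ, γ, hμfin, hμ0, hγm, hγ, hxy⟩ := exists_density_of_eVariationOn_lt_top
    (ψ := fun t => y t - x t) (by simp [hx0]) (fun t ht => h.continuousWithinAt ht)
    fun T hT => h.eVariationOn_lt_top hT
  have hxr : RCLL x := hy.sub_setIntegral hγ fun t ht => by
    rw [← hxy t ht]; abel
  refine ⟨x, ⟨hxK, ?_⟩, hxr⟩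
  obtain ⟨D, hDK, hD, hKD⟩ :=
    (TopologicalSpace.IsSeparable.of_separableSpace K).exists_countable_dense_subset
  obtain ⟨hSeq, hSm⟩ := measurableSet_mem_normalCone hxm hγm hD hDK hKD
  set S := {u | γ u ∈ normalCone K (x u)} with hS
  have hSae : ∀ᵐ u ∂μ, u ∈ S := by
    rw [hSeq]
    simp only [mem_iInter]
    exact (ae_ball_iff hD).2 fun z hz => h.ae_mem_normalCone hxr hxm hμ0 hγ hxy (hDK hz)
  set v : ℝ → E := S.indicator fun u => ‖γ u‖⁻¹ • γ u with hv
  have hρm : Measurable fun u => ENNReal.ofReal ‖γ u‖ := hγm.norm.ennreal_ofReal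
  refine ⟨v, μ.withDensity fun u => ENNReal.ofReal ‖γ u‖, ?_, fun T hT => ?_, fun u => ?_,
    fun u hu => ?_, ?_, fun t ht => ?_⟩
  · exact (hγm.norm.inv.smul hγm).indicator hSm
  · rw [withDensity_apply _ measurableSet_Ico]
    have := ((hγ T).mono_set Ico_subset_Icc_self).norm.lintegral_lt_top
    exact this
  · by_cases hu : u ∈ S
    · rcases eq_or_ne (γ u) 0 with h0 | h0
      · left; simp [hv, h0]
      · right
        rw [hv, indicator_of_mem hu, norm_smul, norm_inv, norm_norm,
          inv_mul_cancel₀ (norm_ne_zero_iff.2 h0)]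
    · left; simp [hv, hu]
  · by_cases huS : u ∈ S
    · rw [hv, indicator_of_mem huS]
      exact smul_mem_normalCone huS (by positivity)
    · rw [hv, indicator_of_notMem huS]
      intro z _
      simp
  · have hm : MeasurableSet {s | x s ∈ frontier K} := hxm isClosed_frontier.measurableSet
    rw [withDensity_apply _ hm.compl]
    refine (setLIntegral_congr_fun_ae hm.compl ?_).trans lintegral_zero
    have hpos : ∀ᵐ u ∂μ, u ∉ Iic (0 : ℝ) := measure_eq_zero_iff_ae_notMem.1 hμ0
    filter_upwards [hSae, hpos] with u huS hu hux
    have hK := hxK u (not_le.1 hu).le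
    have hin : x u ∈ interior K := by
      by_contra hni
      exact hux ⟨subset_closure hK, hni⟩
    simp [eq_zero_of_mem_normalCone_of_mem_interior hin huS]
  · rw [setIntegral_withDensity_eq_setIntegral_toReal_smul hρm
      (Eventually.of_forall fun _ => ENNReal.ofReal_lt_top) _ measurableSet_Icc]
    have : ∫ u in Icc 0 t, (ENNReal.ofReal ‖γ u‖).toReal • v u ∂μ = ∫ u in Icc 0 t, γ u ∂μ := by
      refine integral_congr_ae ?_
      filter_upwards [ae_restrict_of_ae hSae] with u hu
      rw [ENNReal.toReal_ofReal (norm_nonneg _), hv, indicator_of_mem hu, smul_smul]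
      rcases eq_or_ne (γ u) 0 with h0 | h0
      · simp [h0]
      · rw [mul_inv_cancel₀ (norm_ne_zero_iff.2 h0), one_smul]
    rw [this, ← hxy t ht]
    abel

end SkorokhodProblem

/-- Over a polyhedron with nonempty interior, the Skorokhod problem for a
right-continuous path with left limits admits a unique solution, which is itself
right-continuous with left limits. -/
theorem skorokhod_existsUnique_of_polyhedron
    {n : ℕ} (K : Set (EuclideanSpace ℝ (Fin n)))
    (hpoly : ∃ (m : ℕ) (a : Fin m → EuclideanSpace ℝ (Fin n)) (b : Fin m → ℝ),
      K = {p : EuclideanSpace ℝ (Fin n) | ∀ i, ⟪a i, p⟫_ℝ ≤ b i})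
    (hint : (interior K).Nonempty)
    (y : ℝ → EuclideanSpace ℝ (Fin n)) (hy : RCLL y) (hy0 : y 0 ∈ K) :
    ∃ x : ℝ → EuclideanSpace ℝ (Fin n),
      IsSkorokhodSolution K y x ∧ RCLL x ∧
        ∀ x' : ℝ → EuclideanSpace ℝ (Fin n),
          IsSkorokhodSolution K y x' → ∀ t : ℝ, 0 ≤ t → x' t = x t := by
  obtain ⟨m, a, b, rfl⟩ := hpoly
  have hcl : IsClosed {p : EuclideanSpace ℝ (Fin n) | ∀ i, ⟪a i, p⟫_ℝ ≤ b i} := by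
    rw [ofPred_forall]
    exact isClosed_iInter fun i => isClosed_le (by fun_prop) continuous_const
  have hconv : Convex ℝ {p : EuclideanSpace ℝ (Fin n) | ∀ i, ⟪a i, p⟫_ℝ ≤ b i} := by
    rw [ofPred_forall]
    exact convex_iInter fun i => convex_halfSpace_le (innerₛₗ ℝ (a i)).isLinear (b i)
  obtain ⟨x, hx, hxr⟩ := hy.exists_isSkorokhodSolution hcl hconv hint hy0
  refine ⟨x, hx, hxr, fun x' hx' t ht => ?_⟩
  obtain ⟨ν₁, g₁, h₁⟩ := hx'.exists_isReflection
  obtain ⟨ν₂, g₂, h₂⟩ := hx.exists_isReflection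
  exact h₁.eq_of_isReflection h₂ ht

end
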